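/- Let (α_n) and (β_n) be sequences with α_n, β_n > −1 such that α_n/n → ∞, β_n/n → ∞ and α_n/β_n → c for some c > 0 as n → ∞. Set σ = 4c/(1+c)^{3/2}. Then for every ξ with |ξ| ≤ σ, lim_{n→∞} (1/n)·N^{(α_n,β_n)}(√(n/α_n)·ξ − (α_n−β_n)/(α_n+β_n)) = (2/(πσ²)) · ∫_{−σ}^{ξ} √(σ²−x²) dx. -/

import Mathlib

open Filter Topology

/-- Generalized binomial coefficient C(t, m) = t(t-1)⋯(t-m+1)/m! for real t. -/
noncomputable def genBinom (t : ℝ) (m : ℕ) : ℝ :=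
  (∏ i ∈ Finset.range m, (t - (i : ℝ))) / (Nat.factorial m)

/-- Jacobi polynomial P_n^{(α,β)}. -/
noncomputable def jacobiP (n : ℕ) (α β : ℝ) (x : ℝ) : ℝ :=
  ∑ k ∈ Finset.range (n + 1),
    genBinom ((n : ℝ) + α) (n - k) * genBinom ((n : ℝ) + β) k *
      ((x - 1) / 2) ^ k * ((x + 1) / 2) ^ (n - k)

/-- Number of zeros of P_n^{(α,β)} that are ≤ ξ. -/
noncomputable def jacobiN (n : ℕ) (α β ξ : ℝ) : ℕ :=
  {x : ℝ | jacobiP n α β x = 0 ∧ x ≤ ξ}.ncard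

/-- Coefficients of the Jacobi polynomial in the basis `((x-1)/2)^k ((x+1)/2)^(n-k)`. -/
noncomputable def jacobiCoeff (n : ℕ) (α β : ℝ) (k : ℕ) : ℝ :=
  genBinom ((n : ℝ) + α) (n - k) * genBinom ((n : ℝ) + β) k

/-- The Jacobi polynomial as a formal polynomial. -/
noncomputable def jacobiPoly (n : ℕ) (α β : ℝ) : Polynomial ℝ :=
  ∑ k ∈ Finset.range (n + 1),
    Polynomial.C (jacobiCoeff n α β k) *
      ((Polynomial.C (1 / 2) * Polynomial.X - Polynomial.C (1 / 2)) ^ k *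
        (Polynomial.C (1 / 2) * Polynomial.X + Polynomial.C (1 / 2)) ^ (n - k))

theorem eval_jacobiPoly (n : ℕ) (α β x : ℝ) :
    (jacobiPoly n α β).eval x = jacobiP n α β x := by
  unfold jacobiPoly jacobiP jacobiCoeff
  rw [Polynomial.eval_finsetSum]
  refine Finset.sum_congr rfl fun k _ => ?_
  simp only [Polynomial.eval_mul, Polynomial.eval_C, Polynomial.eval_pow, Polynomial.eval_sub,
    Polynomial.eval_add, Polynomial.eval_X]
  rw [show (1 / 2 * x - 1 / 2 : ℝ) = (x - 1) / 2 by ring,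
    show (1 / 2 * x + 1 / 2 : ℝ) = (x + 1) / 2 by ring]
  ring

theorem natDegree_jacobiPoly_le (n : ℕ) (α β : ℝ) : (jacobiPoly n α β).natDegree ≤ n := by
  unfold jacobiPoly
  refine Polynomial.natDegree_sum_le_of_forall_le _ _ fun k hk => ?_
  have hk' : k ≤ n := Nat.lt_succ_iff.mp (Finset.mem_range.mp hk)
  have h1 : (Polynomial.C (1 / 2 : ℝ) * Polynomial.X - Polynomial.C (1 / 2)).natDegree ≤ 1 := by
    compute_degree
  have h2 : (Polynomial.C (1 / 2 : ℝ) * Polynomial.X + Polynomial.C (1 / 2)).natDegree ≤ 1 := by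
    compute_degree
  refine (Polynomial.natDegree_C_mul_le _ _).trans (Polynomial.natDegree_mul_le.trans ?_)
  have h3 := Polynomial.natDegree_pow_le_of_le k h1
  have h4 := Polynomial.natDegree_pow_le_of_le (n - k) h2
  omega

theorem genBinom_pos {n : ℕ} {α : ℝ} (hα : -1 < α) : 0 < genBinom ((n : ℝ) + α) n := by
  unfold genBinom
  refine div_pos (Finset.prod_pos fun i hi => ?_) (by positivity)
  have : (i : ℝ) + 1 ≤ n := by exact_mod_cast Finset.mem_range.mp hi
  linarith

theorem genBinom_succ (t : ℝ) (m : ℕ) :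
    genBinom t (m + 1) * (m + 1) = genBinom t m * (t - m) := by
  unfold genBinom
  rw [Finset.prod_range_succ, Nat.factorial_succ]
  push_cast
  field_simp

theorem jacobiP_one_pos {n : ℕ} {α β : ℝ} (hα : -1 < α) : 0 < jacobiP n α β 1 := by
  unfold jacobiP
  rw [Finset.sum_eq_single 0]
  · simpa [genBinom] using genBinom_pos (n := n) hα
  · intro k _ hk
    simp [hk]
  · simp

theorem jacobiPoly_ne_zero {n : ℕ} {α β : ℝ} (hα : -1 < α) : jacobiPoly n α β ≠ 0 := by
  intro h
  have := jacobiP_one_pos (n := n) (β := β) hα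
  rw [← eval_jacobiPoly, h] at this
  simp at this

theorem setOf_jacobiP_eq_zero {n : ℕ} {α β : ℝ} (hα : -1 < α) :
    {x | jacobiP n α β x = 0} = ((jacobiPoly n α β).roots.toFinset : Set ℝ) := by
  ext x
  simp [Polynomial.mem_roots (jacobiPoly_ne_zero hα), eval_jacobiPoly]

theorem finite_setOf_jacobiP_eq_zero {n : ℕ} {α β : ℝ} (hα : -1 < α) :
    {x | jacobiP n α β x = 0}.Finite := by
  rw [setOf_jacobiP_eq_zero hα]
  exact Finset.finite_toSet _

theorem ncard_setOf_jacobiP_eq_zero_le {n : ℕ} {α β : ℝ} (hα : -1 < α) :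
    {x | jacobiP n α β x = 0}.ncard ≤ n := by
  rw [setOf_jacobiP_eq_zero hα, Set.ncard_coe_finset]
  exact (Multiset.toFinset_card_le _).trans
    ((Polynomial.card_roots' _).trans (natDegree_jacobiPoly_le n α β))

theorem jacobiCoeff_succ {n k : ℕ} (α β : ℝ) (hk : k < n) :
    jacobiCoeff n α β (k + 1) * ((k + 1) * (k + 1 + α)) =
      jacobiCoeff n α β k * ((n - k : ℕ) * ((n - k : ℕ) + β)) := by
  obtain ⟨j, rfl⟩ : ∃ j, n = k + 1 + j := ⟨n - (k + 1), by omega⟩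
  unfold jacobiCoeff
  rw [show k + 1 + j - (k + 1) = j by omega, show k + 1 + j - k = j + 1 by omega]
  have h1 := genBinom_succ (((k + 1 + j : ℕ) : ℝ) + α) j
  have h2 := genBinom_succ (((k + 1 + j : ℕ) : ℝ) + β) k
  push_cast at h1 h2 ⊢
  linear_combination
    genBinom ((k : ℝ) + 1 + j + α) j * (k + 1 + α) * h2 -
      genBinom ((k : ℝ) + 1 + j + β) k * (j + 1 + β) * h1

/-- The differential operator of the Jacobi equation applied to `u^k v^j`, where `u = (x-1)/2` and
`v = (x+1)/2`. -/
theorem jacobi_operator_monomial (α β x : ℝ) (k j : ℕ) :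
    let p : Polynomial ℝ := (Polynomial.C (1 / 2) * Polynomial.X - Polynomial.C (1 / 2)) ^ k *
        (Polynomial.C (1 / 2) * Polynomial.X + Polynomial.C (1 / 2)) ^ j
    (1 - x ^ 2) * p.derivative.derivative.eval x +
        (β - α - (α + β + 2) * x) * p.derivative.eval x +
        ((k + j : ℝ) * (k + j + α + β + 1)) * p.eval x =
      j * (j + β) * ((x - 1) / 2) ^ k * ((x + 1) / 2) ^ (j - 1) -
        k * (k + α) * ((x - 1) / 2) ^ (k - 1) * ((x + 1) / 2) ^ j := by
  intro p
  obtain ⟨u, hu⟩ : ∃ u, u = (x - 1) / 2 := ⟨_, rfl⟩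
  obtain ⟨v, hv⟩ : ∃ v, v = (x + 1) / 2 := ⟨_, rfl⟩
  have e1 : (1 / 2 * x - 1 / 2 : ℝ) = u := by rw [hu]; ring
  have e2 : (1 / 2 * x + 1 / 2 : ℝ) = v := by rw [hv]; ring
  have hx : 1 - x ^ 2 = -4 * u * v := by rw [hu, hv]; ring
  have hx' : β - α - (α + β + 2) * x = -2 * ((β + 1) * u + (α + 1) * v) := by
    rw [hu, hv]; ring
  have huv : v - u = 1 := by rw [hu, hv]; ring
  rw [← hu, ← hv, hx, hx']
  have key : ∀ H G : ℝ, H - G = (v - u) * (H - G) := by intro H G; rw [huv, one_mul]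
  rw [key]
  rcases k with _ | _ | k <;> rcases j with _ | _ | j <;>
    simp [p, Polynomial.derivative_mul, Polynomial.derivative_pow, -one_div, e1, e2] <;> ring

/-- The Jacobi differential equation. -/
theorem jacobiPoly_ode (n : ℕ) (α β x : ℝ) :
    (1 - x ^ 2) * (jacobiPoly n α β).derivative.derivative.eval x +
        (β - α - (α + β + 2) * x) * (jacobiPoly n α β).derivative.eval x +
        (n * (n + α + β + 1)) * (jacobiPoly n α β).eval x = 0 := by
  unfold jacobiPoly
  simp only [Polynomial.derivative_sum, Polynomial.eval_finsetSum, Finset.mul_sum,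
    ← Finset.sum_add_distrib, Polynomial.derivative_C_mul, Polynomial.eval_C_mul]
  calc _ = ∑ k ∈ Finset.range (n + 1), jacobiCoeff n α β k *
        (((n - k : ℕ) : ℝ) * ((n - k : ℕ) + β) * ((x - 1) / 2) ^ k *
            ((x + 1) / 2) ^ (n - k - 1) -
          k * (k + α) * ((x - 1) / 2) ^ (k - 1) * ((x + 1) / 2) ^ (n - k)) := by
        refine Finset.sum_congr rfl fun k hk => ?_
        have h := jacobi_operator_monomial α β x k (n - k)
        have hn : (k : ℝ) + ((n - k : ℕ) : ℝ) = n := by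
          rw [Nat.cast_sub (Nat.lt_succ_iff.mp (Finset.mem_range.mp hk))]
          ring
        rw [hn] at h
        linear_combination jacobiCoeff n α β k * h
    _ = 0 := by
        simp only [mul_sub, Finset.sum_sub_distrib]
        rw [Finset.sum_range_succ, Finset.sum_range_succ']
        simp only [Nat.sub_self, Nat.cast_zero, zero_mul, mul_zero, add_zero]
        rw [← Finset.sum_sub_distrib]
        refine Finset.sum_eq_zero fun k hk => ?_
        have h := jacobiCoeff_succ α β (Finset.mem_range.mp hk)
        rw [Nat.add_sub_cancel, Nat.sub_sub]
        push_cast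
        linear_combination -(((x - 1) / 2) ^ k * ((x + 1) / 2) ^ (n - (k + 1))) * h

/-- Sturm comparison with `sin (M (x - a))`: solutions of `w'' + Q w = 0` with `M² ≤ Q` are not
positive on a half-open interval of length `π / M`. -/
theorem not_forall_pos_of_sq_le {w w' Q : ℝ → ℝ} {a M : ℝ} (hM : 0 < M)
    (hw : ∀ x ∈ Set.Icc a (a + Real.pi / M), HasDerivAt w (w' x) x)
    (hw' : ∀ x ∈ Set.Icc a (a + Real.pi / M), HasDerivAt w' (-(Q x) * w x) x)
    (hQ : ∀ x ∈ Set.Icc a (a + Real.pi / M), M ^ 2 ≤ Q x) :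
    ¬ ∀ x ∈ Set.Ioc a (a + Real.pi / M), 0 < w x := by
  intro hpos
  have hlen : 0 < Real.pi / M := div_pos Real.pi_pos hM
  have hderiv : ∀ x ∈ Set.Icc a (a + Real.pi / M),
      HasDerivAt (fun x => w' x * Real.sin (M * (x - a)) - w x * (M * Real.cos (M * (x - a))))
        ((M ^ 2 - Q x) * (w x * Real.sin (M * (x - a)))) x := by
    intro x hx
    have h0 : HasDerivAt (fun x => M * (x - a)) M x := by
      simpa using ((hasDerivAt_id x).sub_const a).const_mul M
    refine (((hw' x hx).mul h0.sin).sub ((hw x hx).mul (h0.cos.const_mul M))).congr_deriv ?_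
    ring
  have hanti : AntitoneOn
      (fun x => w' x * Real.sin (M * (x - a)) - w x * (M * Real.cos (M * (x - a))))
      (Set.Icc a (a + Real.pi / M)) := by
    refine antitoneOn_of_deriv_nonpos (convex_Icc _ _)
      (fun x hx => (hderiv x hx).continuousAt.continuousWithinAt)
      (fun x hx => (hderiv x (interior_subset hx)).differentiableAt.differentiableWithinAt)
      fun x hx => ?_
    rw [(hderiv x (interior_subset hx)).deriv]
    rw [interior_Icc] at hx
    have hs : 0 ≤ Real.sin (M * (x - a)) := by
      refine Real.sin_nonneg_of_nonneg_of_le_pi (mul_nonneg hM.le (by linarith [hx.1])) ?_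
      have : x - a ≤ Real.pi / M := by linarith [hx.2]
      calc M * (x - a) ≤ M * (Real.pi / M) := by gcongr
        _ = Real.pi := by field_simp
    exact mul_nonpos_of_nonpos_of_nonneg (by linarith [hQ x ⟨hx.1.le, hx.2.le⟩])
      (mul_nonneg (hpos x ⟨hx.1, hx.2.le⟩).le hs)
  have hle := hanti (Set.left_mem_Icc.mpr (by linarith)) (Set.right_mem_Icc.mpr (by linarith))
    (by linarith : a ≤ a + Real.pi / M)
  have hpi : M * (a + Real.pi / M - a) = Real.pi := by field_simp; ring
  simp only [hpi, sub_self, mul_zero, Real.sin_zero, Real.cos_zero, Real.sin_pi,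
    Real.cos_pi] at hle
  have hb := hpos _ (Set.right_mem_Ioc.mpr (by linarith : a < a + Real.pi / M))
  have hcont : ContinuousWithinAt w (Set.Ioi a) a :=
    (hw a (Set.left_mem_Icc.mpr (by linarith))).continuousAt.continuousWithinAt
  have ha : 0 ≤ w a := by
    refine ge_of_tendsto hcont ?_
    filter_upwards [Ioc_mem_nhdsGT (by linarith : a < a + Real.pi / M)] with x hx
    exact (hpos x hx).le
  nlinarith [mul_pos hM hb, mul_nonneg hM.le ha]

theorem exists_zero_of_sq_le {w w' Q : ℝ → ℝ} {a M : ℝ} (hM : 0 < M)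
    (hw : ∀ x ∈ Set.Icc a (a + Real.pi / M), HasDerivAt w (w' x) x)
    (hw' : ∀ x ∈ Set.Icc a (a + Real.pi / M), HasDerivAt w' (-(Q x) * w x) x)
    (hQ : ∀ x ∈ Set.Icc a (a + Real.pi / M), M ^ 2 ≤ Q x) :
    ∃ x ∈ Set.Ioc a (a + Real.pi / M), w x = 0 := by
  have hlen : 0 < Real.pi / M := div_pos Real.pi_pos hM
  by_contra! hne
  have hcont : ContinuousOn w (Set.Ioc a (a + Real.pi / M)) := fun x hx =>
    (hw x (Set.Ioc_subset_Icc_self hx)).continuousAt.continuousWithinAt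
  by_cases hex : ∃ x ∈ Set.Ioc a (a + Real.pi / M), w x < 0
  · obtain ⟨x, hx, hxn⟩ := hex
    refine not_forall_pos_of_sq_le (w := fun x => -w x) (w' := fun x => -w' x) hM
      (fun x hx => (hw x hx).neg) (fun x hx => ((hw' x hx).neg).congr_deriv (by ring)) hQ
      fun y hy => ?_
    by_contra! hy0
    obtain ⟨z, hz, hz0⟩ := isPreconnected_Ioc.intermediate_value hx hy hcont
      (show (0 : ℝ) ∈ Set.Icc (w x) (w y) from ⟨hxn.le, by linarith⟩)
    exact hne z hz hz0
  · push Not at hex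
    exact not_forall_pos_of_sq_le hM hw hw' hQ fun y hy => (hex y hy).lt_of_ne' (hne y hy)

theorem ncard_inter_Ioc_add {S : Set ℝ} (hS : S.Finite) {a b c : ℝ} (hab : a ≤ b) (hbc : b ≤ c) :
    (S ∩ Set.Ioc a b).ncard + (S ∩ Set.Ioc b c).ncard = (S ∩ Set.Ioc a c).ncard := by
  rw [← Set.ncard_union_eq _ (hS.inter_of_left _) (hS.inter_of_left _),
    ← Set.inter_union_distrib_left, Set.Ioc_union_Ioc_eq_Ioc hab hbc]
  exact (Set.Ioc_disjoint_Ioc_of_le le_rfl).mono Set.inter_subset_right Set.inter_subset_right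

/-- Sturm's lower bound for the number of zeros of a solution of `w'' + Q w = 0`. -/
theorem le_ncard_zeros_of_sq_le {w w' Q : ℝ → ℝ} {b M : ℝ} (hM : 0 < M)
    {S : Set ℝ} (hS : S.Finite) (k : ℕ) : ∀ a : ℝ, a + k * (Real.pi / M) ≤ b →
    (∀ x ∈ Set.Icc a b, HasDerivAt w (w' x) x) →
    (∀ x ∈ Set.Icc a b, HasDerivAt w' (-(Q x) * w x) x) →
    (∀ x ∈ Set.Icc a b, M ^ 2 ≤ Q x) →
    (∀ x ∈ Set.Icc a b, w x = 0 → x ∈ S) →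
    k ≤ (S ∩ Set.Ioc a b).ncard := by
  have hlen : 0 < Real.pi / M := div_pos Real.pi_pos hM
  induction k with
  | zero => intros; exact Nat.zero_le _
  | succ k ih =>
    intro a hab hw hw' hQ hwS
    push_cast at hab
    have hkl : 0 ≤ k * (Real.pi / M) := by positivity
    have hcb : a + Real.pi / M ≤ b := by linarith
    have hsub : Set.Icc a (a + Real.pi / M) ⊆ Set.Icc a b := Set.Icc_subset_Icc_right hcb
    have hsub' : Set.Icc (a + Real.pi / M) b ⊆ Set.Icc a b :=
      Set.Icc_subset_Icc_left (by linarith)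
    have h1 := ih (a + Real.pi / M) (by linarith) (fun x hx => hw x (hsub' hx))
      (fun x hx => hw' x (hsub' hx)) (fun x hx => hQ x (hsub' hx)) (fun x hx => hwS x (hsub' hx))
    obtain ⟨z, hz, hz0⟩ := exists_zero_of_sq_le hM (fun x hx => hw x (hsub hx))
      (fun x hx => hw' x (hsub hx)) (fun x hx => hQ x (hsub hx))
    have h2 : 0 < (S ∩ Set.Ioc a (a + Real.pi / M)).ncard :=
      (Set.ncard_pos (hS.inter_of_left _)).mpr
        ⟨z, hwS z (hsub (Set.Ioc_subset_Icc_self hz)) hz0, hz⟩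
    have h3 := ncard_inter_Ioc_add hS (by linarith : a ≤ a + Real.pi / M) hcb
    omega

/-- The weight `(1-x)^((α+1)/2) (1+x)^((β+1)/2)` bringing the Jacobi equation to normal form. -/
noncomputable def jacobiWeight (α β x : ℝ) : ℝ :=
  Real.exp ((α + 1) / 2 * Real.log (1 - x) + (β + 1) / 2 * Real.log (1 + x))

/-- The potential of the normal form of the Jacobi equation. -/
noncomputable def jacobiPotential (n : ℕ) (α β x : ℝ) : ℝ :=
  (-((α - β) + (α + β) * x) ^ 2 + 2 + 2 * x ^ 2 +
    2 * (1 - x ^ 2) * (2 * n ^ 2 + (2 * n + 1) * (α + β + 1))) / (4 * (1 - x ^ 2) ^ 2)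

theorem hasDerivAt_jacobiWeight (α β : ℝ) {x : ℝ} (h1 : 1 - x ≠ 0) (h2 : 1 + x ≠ 0) :
    HasDerivAt (jacobiWeight α β)
      (jacobiWeight α β x * ((β + 1) / 2 / (1 + x) - (α + 1) / 2 / (1 - x))) x := by
  have e1 : HasDerivAt (fun x : ℝ => 1 - x) (-1) x := by
    simpa using (hasDerivAt_id x).const_sub 1
  have e2 : HasDerivAt (fun x : ℝ => 1 + x) 1 x := by
    simpa using (hasDerivAt_id x).const_add 1
  refine (((e1.log h1).const_mul ((α + 1) / 2)).add
    ((e2.log h2).const_mul ((β + 1) / 2))).exp.congr_deriv ?_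
  rw [jacobiWeight]
  simp only [Pi.add_apply]
  ring

/-- The derivative of the weighted Jacobi polynomial. -/
noncomputable def weightedJacobiDeriv (n : ℕ) (α β x : ℝ) : ℝ :=
  jacobiWeight α β x * ((jacobiPoly n α β).derivative.eval x +
    ((β + 1) / 2 / (1 + x) - (α + 1) / 2 / (1 - x)) * (jacobiPoly n α β).eval x)

theorem hasDerivAt_weightedJacobi (n : ℕ) (α β : ℝ) {x : ℝ} (h1 : 1 - x ≠ 0) (h2 : 1 + x ≠ 0) :
    HasDerivAt (fun x => jacobiWeight α β x * (jacobiPoly n α β).eval x)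
      (weightedJacobiDeriv n α β x) x := by
  refine ((hasDerivAt_jacobiWeight α β h1 h2).mul
    ((jacobiPoly n α β).hasDerivAt x)).congr_deriv ?_
  rw [weightedJacobiDeriv]
  ring

theorem hasDerivAt_weightedJacobiDeriv (n : ℕ) (α β : ℝ) {x : ℝ} (h1 : 1 - x ≠ 0)
    (h2 : 1 + x ≠ 0) :
    HasDerivAt (weightedJacobiDeriv n α β)
      (-jacobiPotential n α β x * (jacobiWeight α β x * (jacobiPoly n α β).eval x)) x := by
  have e1 : HasDerivAt (fun x : ℝ => 1 - x) (-1) x := by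
    simpa using (hasDerivAt_id x).const_sub 1
  have e2 : HasDerivAt (fun x : ℝ => 1 + x) 1 x := by
    simpa using (hasDerivAt_id x).const_add 1
  have hg := ((hasDerivAt_const x ((β + 1) / 2)).div e2 h2).sub
    ((hasDerivAt_const x ((α + 1) / 2)).div e1 h1)
  refine ((hasDerivAt_jacobiWeight α β h1 h2).mul
    (((jacobiPoly n α β).derivative.hasDerivAt x).add
      (hg.mul ((jacobiPoly n α β).hasDerivAt x)))).congr_deriv ?_
  have ode := jacobiPoly_ode n α β x
  simp only [Pi.sub_apply, Pi.div_apply, Pi.add_apply, Pi.mul_apply]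
  generalize (jacobiPoly n α β).derivative.derivative.eval x = y2 at *
  generalize (jacobiPoly n α β).derivative.eval x = y1 at *
  generalize (jacobiPoly n α β).eval x = y0 at *
  generalize jacobiWeight α β x = E at *
  have h3 : 1 - x ^ 2 ≠ 0 := by
    rw [show 1 - x ^ 2 = (1 - x) * (1 + x) by ring]
    exact mul_ne_zero h1 h2
  have hy2 : y2 = -((β - α - (α + β + 2) * x) * y1 + n * (n + α + β + 1) * y0) /
      ((1 - x) * (1 + x)) := by
    rw [eq_div_iff (mul_ne_zero h1 h2)]
    linear_combination ode
  rw [hy2, jacobiPotential, show 1 - x ^ 2 = (1 - x) * (1 + x) by ring]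
  field_simp
  ring

/-- Lower bound for the number of Jacobi zeros where the potential is at least `M²`. -/
theorem le_ncard_jacobi_zeros {n : ℕ} {α β a b M : ℝ} (hα : -1 < α) (hM : 0 < M) (k : ℕ)
    (hab : a + k * (Real.pi / M) ≤ b) (hx : ∀ x ∈ Set.Icc a b, 0 < 1 - x ^ 2)
    (hQ : ∀ x ∈ Set.Icc a b, M ^ 2 ≤ jacobiPotential n α β x) :
    k ≤ ({x | jacobiP n α β x = 0} ∩ Set.Ioc a b).ncard := by
  have h1 : ∀ x ∈ Set.Icc a b, 1 - x ≠ 0 := fun x hxi h => by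
    have := hx x hxi
    rw [show 1 - x ^ 2 = (1 - x) * (1 + x) by ring, h, zero_mul] at this
    exact this.false
  have h2 : ∀ x ∈ Set.Icc a b, 1 + x ≠ 0 := fun x hxi h => by
    have := hx x hxi
    rw [show 1 - x ^ 2 = (1 - x) * (1 + x) by ring, h, mul_zero] at this
    exact this.false
  refine le_ncard_zeros_of_sq_le hM (finite_setOf_jacobiP_eq_zero hα) k a hab
    (fun x hxi => hasDerivAt_weightedJacobi n α β (h1 x hxi) (h2 x hxi))
    (fun x hxi => hasDerivAt_weightedJacobiDeriv n α β (h1 x hxi) (h2 x hxi)) hQ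
    fun x _ h0 => ?_
  rw [eval_jacobiPoly] at h0
  exact (mul_eq_zero.mp h0).resolve_left (Real.exp_ne_zero _)

/-- The affine rescaling of the variable used in the asymptotics of the zeros. -/
noncomputable def jacobiScale (n : ℕ) (α β s : ℝ) : ℝ :=
  Real.sqrt ((n : ℝ) / α) * s - (α - β) / (α + β)

theorem jacobiScale_mono (n : ℕ) (α β : ℝ) : Monotone (jacobiScale n α β) := fun _ _ h =>
  sub_le_sub_right (mul_le_mul_of_nonneg_left h (Real.sqrt_nonneg _)) _

/-- The number of zeros with rescaled position in `(a, b]`. -/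
noncomputable def scaledCount (n : ℕ) (α β a b : ℝ) : ℕ :=
  ({x | jacobiP n α β x = 0} ∩ Set.Ioc (jacobiScale n α β a) (jacobiScale n α β b)).ncard

theorem scaledCount_add (n : ℕ) {α β a b c : ℝ} (hα : -1 < α) (hab : a ≤ b) (hbc : b ≤ c) :
    scaledCount n α β a b + scaledCount n α β b c = scaledCount n α β a c :=
  ncard_inter_Ioc_add (finite_setOf_jacobiP_eq_zero hα) (jacobiScale_mono n α β hab)
    (jacobiScale_mono n α β hbc)

theorem le_scaledCount {n : ℕ} {α β r a b : ℝ} (hn : 0 < n) (hα : 0 < α) (hβ : 0 < β)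
    (hr : 0 < r) (hab : a ≤ b)
    (h : ∀ s ∈ Set.Icc a b, 0 < 1 - jacobiScale n α β s ^ 2 ∧
      4 * (1 - jacobiScale n α β s ^ 2) ^ 2 * (Real.pi * r) ^ 2 ≤
        -(1 + β / α) ^ 2 * s ^ 2 + 4 * (1 - jacobiScale n α β s ^ 2) * (1 + β / α)) :
    n * (r * (b - a)) - 1 ≤ scaledCount n α β a b := by
  have hn' : (0 : ℝ) < n := by exact_mod_cast hn
  have hh : 0 < Real.sqrt ((n : ℝ) / α) := Real.sqrt_pos.mpr (div_pos hn' hα)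
  have hh2 : Real.sqrt ((n : ℝ) / α) ^ 2 = n / α := Real.sq_sqrt (div_pos hn' hα).le
  have hs : ∀ x ∈ Set.Icc (jacobiScale n α β a) (jacobiScale n α β b),
      ∃ s ∈ Set.Icc a b, x = jacobiScale n α β s := by
    intro x hx
    refine ⟨(x + (α - β) / (α + β)) / Real.sqrt ((n : ℝ) / α), ⟨?_, ?_⟩, ?_⟩
    · rw [le_div_iff₀ hh]
      have := hx.1
      unfold jacobiScale at this
      linarith
    · rw [div_le_iff₀ hh]
      have := hx.2
      unfold jacobiScale at this
      linarith
    · unfold jacobiScale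
      field_simp
      ring
  have hM : 0 < Real.pi * r * (Real.sqrt ((n : ℝ) / α) * α) := by
    have := Real.pi_pos
    positivity
  have hM2 : (Real.pi * r * (Real.sqrt ((n : ℝ) / α) * α)) ^ 2 = (Real.pi * r) ^ 2 * (n * α) := by
    rw [mul_pow, mul_pow (Real.sqrt _), hh2]
    field_simp
  have hk := Nat.floor_le (mul_nonneg hn'.le (mul_nonneg hr.le (sub_nonneg.mpr hab)))
  have hk' := Nat.lt_floor_add_one ((n : ℝ) * (r * (b - a)))
  have hmain := le_ncard_jacobi_zeros (n := n) (α := α) (β := β) (a := jacobiScale n α β a)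
    (b := jacobiScale n α β b) (by linarith) hM ⌊(n : ℝ) * (r * (b - a))⌋₊ ?_ ?_ ?_
  · have : ((⌊(n : ℝ) * (r * (b - a))⌋₊ : ℕ) : ℝ) ≤ scaledCount n α β a b := by
      exact_mod_cast hmain
    linarith
  · have hle : (⌊(n : ℝ) * (r * (b - a))⌋₊ : ℝ) *
        (Real.pi / (Real.pi * r * (Real.sqrt ((n : ℝ) / α) * α))) ≤
        Real.sqrt ((n : ℝ) / α) * (b - a) := by
      rw [← mul_div_assoc, div_le_iff₀ hM]
      have e : Real.sqrt ((n : ℝ) / α) * (b - a) *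
          (Real.pi * r * (Real.sqrt ((n : ℝ) / α) * α)) = n * (r * (b - a)) * Real.pi := by
        have : Real.sqrt ((n : ℝ) / α) ^ 2 * α = n := by rw [hh2]; field_simp
        linear_combination (b - a) * Real.pi * r * this
      rw [e]
      exact mul_le_mul_of_nonneg_right hk Real.pi_pos.le
    unfold jacobiScale
    linarith
  · intro x hx
    obtain ⟨s, hs, rfl⟩ := hs x hx
    exact (h s hs).1
  · intro x hx
    obtain ⟨s, hs, rfl⟩ := hs x hx
    obtain ⟨h1, h2⟩ := h s hs
    have hlin : (α - β) + (α + β) * jacobiScale n α β s =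
        (α + β) * (Real.sqrt ((n : ℝ) / α) * s) := by
      have : α + β ≠ 0 := by positivity
      unfold jacobiScale
      field_simp
      ring
    rw [hM2, jacobiPotential, hlin, mul_pow (α + β), mul_pow (Real.sqrt _), hh2,
      le_div_iff₀ (by positivity)]
    generalize jacobiScale n α β s = x at *
    have h3 := mul_le_mul_of_nonneg_left h2 (mul_pos hn' hα).le
    have h4 : (n : ℝ) * α * (-(1 + β / α) ^ 2 * s ^ 2 + 4 * (1 - x ^ 2) * (1 + β / α)) =
        -((α + β) ^ 2 * (n / α * s ^ 2)) + 4 * n * (1 - x ^ 2) * (α + β) := by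
      field_simp
    rw [h4] at h3
    have h5 : 0 ≤ (1 - x ^ 2) * (2 * n ^ 2 + 2 * n + (α + β + 1)) := by positivity
    nlinarith [sq_nonneg x]

/-- The limiting density of the rescaled zeros. -/
noncomputable def semicircleDensity (σ s : ℝ) : ℝ :=
  2 / (Real.pi * σ ^ 2) * Real.sqrt (σ ^ 2 - s ^ 2)

theorem continuous_semicircleDensity (σ : ℝ) : Continuous (semicircleDensity σ) := by
  unfold semicircleDensity
  fun_prop

theorem integral_semicircleDensity {σ : ℝ} (hσ : 0 < σ) :
    ∫ s in (-σ)..σ, semicircleDensity σ s = 1 := by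
  have h := intervalIntegral.integral_comp_mul_left
    (fun x => Real.sqrt (σ ^ 2 - x ^ 2)) (a := -1) (b := 1) hσ.ne'
  have h2 : ∀ x : ℝ, Real.sqrt (σ ^ 2 - (σ * x) ^ 2) = σ * Real.sqrt (1 - x ^ 2) := by
    intro x
    rw [show σ ^ 2 - (σ * x) ^ 2 = σ ^ 2 * (1 - x ^ 2) by ring, Real.sqrt_mul (sq_nonneg σ),
      Real.sqrt_sq hσ.le]
  simp only [h2, intervalIntegral.integral_const_mul, integral_sqrt_one_sub_sq, smul_eq_mul,
    mul_neg, mul_one] at h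
  unfold semicircleDensity
  have hpi := Real.pi_pos
  rw [intervalIntegral.integral_const_mul]
  have h3 : ∫ x in (-σ)..σ, Real.sqrt (σ ^ 2 - x ^ 2) = σ ^ 2 * (Real.pi / 2) := by
    field_simp at h ⊢
    linarith
  rw [h3]
  field_simp

theorem sq_lt_of_lt_semicircleDensity {σ r s : ℝ} (hσ : 0 < σ) (hr : 0 < r)
    (h : r < semicircleDensity σ s) :
    (Real.pi * r) ^ 2 * σ ^ 4 < 4 * (σ ^ 2 - s ^ 2) := by
  unfold semicircleDensity at h
  have hpi := Real.pi_pos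
  have hs : 0 ≤ σ ^ 2 - s ^ 2 := by
    by_contra! hneg
    rw [Real.sqrt_eq_zero_of_nonpos hneg.le, mul_zero] at h
    linarith
  have h1 : Real.pi * r * σ ^ 2 < 2 * Real.sqrt (σ ^ 2 - s ^ 2) := by
    rw [div_mul_eq_mul_div, lt_div_iff₀ (by positivity)] at h
    linarith
  have h2 := pow_lt_pow_left₀ h1 (by positivity) two_ne_zero
  rw [mul_pow 2, Real.sq_sqrt hs] at h2
  linarith

theorem eventually_forall_potential_bound {c σ r a b : ℝ} (hc : 0 < c) (hσ : 0 < σ)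
    (hσc : σ ^ 2 * (1 + c) ^ 3 = 16 * c ^ 2) (hr : 0 < r)
    (h : ∀ s ∈ Set.Icc a b, r < semicircleDensity σ s) :
    ∀ᶠ p : ℝ × ℝ × ℝ in 𝓝 (0, (c - 1) / (c + 1), c⁻¹), ∀ s ∈ Set.Icc a b,
      0 < 1 - (p.1 * s - p.2.1) ^ 2 ∧
      4 * (1 - (p.1 * s - p.2.1) ^ 2) ^ 2 * (Real.pi * r) ^ 2 <
        -(1 + p.2.2) ^ 2 * s ^ 2 + 4 * (1 - (p.1 * s - p.2.1) ^ 2) * (1 + p.2.2) := by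
  refine isCompact_Icc.eventually_forall_of_forall_eventually fun s hs => ?_
  have hlt := sq_lt_of_lt_semicircleDensity hσ hr (h s hs)
  have hx : 1 - (0 * s - (c - 1) / (c + 1)) ^ 2 = 4 * c / (1 + c) ^ 2 := by
    field_simp
    ring
  refine Filter.Eventually.and ?_ ?_
  · refine ContinuousAt.eventually_lt (f := fun _ => (0 : ℝ)) (by fun_prop) (by fun_prop) ?_
    simp only [hx]
    positivity
  · refine ContinuousAt.eventually_lt (by fun_prop) (by fun_prop) ?_
    simp only [hx]
    have e1 : σ ^ 2 = 16 * c ^ 2 / (1 + c) ^ 3 := by rw [eq_div_iff (by positivity), hσc]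
    have e2 : σ ^ 4 = 256 * c ^ 4 / (1 + c) ^ 6 := by
      rw [show σ ^ 4 = (σ ^ 2) ^ 2 by ring, e1]
      field_simp
      ring
    rw [e1, e2] at hlt
    have hpos : 0 < (1 + c) ^ 2 / (4 * c ^ 2) := by positivity
    have h2 := mul_lt_mul_of_pos_right hlt hpos
    convert h2 using 1
    · field_simp
      ring
    · field_simp
      ring

section Asymptotics

variable {α β : ℕ → ℝ} {c σ : ℝ}

theorem eventually_le_scaledCount_of_lt_density (hc : 0 < c)
    (hαlim : Tendsto (fun n : ℕ => α n / n) atTop atTop)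
    (hβlim : Tendsto (fun n : ℕ => β n / n) atTop atTop)
    (hq : Tendsto (fun n : ℕ => α n / β n) atTop (𝓝 c))
    (hσ : 0 < σ) (hσc : σ ^ 2 * (1 + c) ^ 3 = 16 * c ^ 2) {a b r : ℝ} (hab : a ≤ b)
    (h : ∀ s ∈ Set.Icc a b, r < semicircleDensity σ s) :
    ∀ᶠ n : ℕ in atTop, n * (r * (b - a)) - 1 ≤ scaledCount n (α n) (β n) a b := by
  rcases le_or_gt r 0 with hr | hr
  · refine Eventually.of_forall fun n => ?_
    have h1 : (n : ℝ) * (r * (b - a)) ≤ 0 := mul_nonpos_of_nonneg_of_nonpos n.cast_nonneg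
      (mul_nonpos_of_nonpos_of_nonneg hr (sub_nonneg.mpr hab))
    have h2 : (0 : ℝ) ≤ scaledCount n (α n) (β n) a b := Nat.cast_nonneg _
    linarith
  have hpos : ∀ γ : ℕ → ℝ, Tendsto (fun n : ℕ => γ n / n) atTop atTop →
      ∀ᶠ n in atTop, 0 < γ n := by
    intro γ hγ
    filter_upwards [hγ.eventually_gt_atTop 0, eventually_gt_atTop 0] with n h1 h2
    have h2' : (0 : ℝ) < n := by exact_mod_cast h2
    rwa [lt_div_iff₀ h2', zero_mul] at h1
  have hα0 := hpos α hαlim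
  have hβ0 := hpos β hβlim
  have t1 : Tendsto (fun n : ℕ => Real.sqrt ((n : ℝ) / α n)) atTop (𝓝 0) := by
    have := (Real.continuous_sqrt.tendsto 0).comp hαlim.inv_tendsto_atTop
    rw [Real.sqrt_zero] at this
    exact this.congr fun n => by simp
  have t2 : Tendsto (fun n : ℕ => (α n - β n) / (α n + β n)) atTop (𝓝 ((c - 1) / (c + 1))) := by
    refine ((hq.sub_const 1).div (hq.add_const 1) (by positivity)).congr' ?_
    filter_upwards [hα0, hβ0] with n h1 h2
    simp only [Pi.div_apply]
    field_simp
  have t3 : Tendsto (fun n : ℕ => β n / α n) atTop (𝓝 c⁻¹) :=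
    (hq.inv₀ hc.ne').congr fun n => inv_div _ _
  filter_upwards [hα0, hβ0, eventually_gt_atTop 0, (t1.prodMk_nhds (t2.prodMk_nhds t3)).eventually
    (eventually_forall_potential_bound hc hσ hσc hr h)] with n h1 h2 h3 h4
  exact le_scaledCount h3 h1 h2 hr hab fun s hs => ⟨(h4 s hs).1, (h4 s hs).2.le⟩

theorem eventually_integral_le_scaledCount (hc : 0 < c) (hα : ∀ n, -1 < α n)
    (hαlim : Tendsto (fun n : ℕ => α n / n) atTop atTop)
    (hβlim : Tendsto (fun n : ℕ => β n / n) atTop atTop)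
    (hq : Tendsto (fun n : ℕ => α n / β n) atTop (𝓝 c))
    (hσ : 0 < σ) (hσc : σ ^ 2 * (1 + c) ^ 3 = 16 * c ^ 2) {a b ε : ℝ} (hab : a ≤ b)
    (hε : 0 < ε) :
    ∀ᶠ n : ℕ in atTop,
      (∫ s in a..b, semicircleDensity σ s) - ε ≤ scaledCount n (α n) (β n) a b / n := by
  obtain ⟨η, hη, hηε⟩ : ∃ η > 0, 2 * η * (b - a) < ε / 2 := by
    refine ⟨ε / 2 / (2 * (b - a + 1)), div_pos (by positivity) (by linarith), ?_⟩
    have : 0 < b - a + 1 := by linarith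
    field_simp
    linarith
  have huc := isCompact_Icc.uniformContinuousOn_of_continuous
    (continuous_semicircleDensity σ).continuousOn (s := Set.Icc a b)
  obtain ⟨δ, hδ, hδη⟩ := Metric.uniformContinuousOn_iff.mp huc η hη
  have hint : ∀ x y, IntervalIntegrable (semicircleDensity σ) MeasureTheory.volume x y :=
    fun x y => (continuous_semicircleDensity σ).intervalIntegrable x y
  have key : ∀ j : ℕ, ∀ y ∈ Set.Icc a b, y - a ≤ j * (δ / 2) → ∀ᶠ n : ℕ in atTop,
      n * ((∫ s in a..y, semicircleDensity σ s) - 2 * η * (y - a)) - j ≤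
        scaledCount n (α n) (β n) a y := by
    intro j
    induction j with
    | zero =>
      intro y hy hya
      have : y = a := by
        have := hy.1
        norm_num at hya
        linarith
      subst this
      exact Eventually.of_forall fun n => by simp
    | succ j ih =>
      intro y hy hya
      push_cast at hya
      obtain ⟨m, hm⟩ : ∃ m, m = max a (y - δ / 2) := ⟨_, rfl⟩
      have ham : a ≤ m := hm ▸ le_max_left _ _
      have hmy : m ≤ y := hm ▸ max_le hy.1 (by linarith)
      have hym : y - δ / 2 ≤ m := hm ▸ le_max_right _ _
      have hmj : m - a ≤ j * (δ / 2) := by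
        have : m ≤ a + j * (δ / 2) := by
          rw [hm]
          have : 0 ≤ j * (δ / 2) := by positivity
          exact max_le (by linarith) (by linarith)
        linarith
      have hclose : ∀ s ∈ Set.Icc m y,
          |semicircleDensity σ s - semicircleDensity σ m| < η := fun s hs => by
        refine hδη s ⟨ham.trans hs.1, hs.2.trans hy.2⟩ m ⟨ham, hmy.trans hy.2⟩ ?_
        rw [Real.dist_eq, abs_of_nonneg (by linarith [hs.1])]
        linarith [hs.2]
      have hle : ∫ s in m..y, semicircleDensity σ s ≤ (semicircleDensity σ m + η) * (y - m) := by
        have := intervalIntegral.integral_mono_on hmy (hint m y)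
          (intervalIntegrable_const (c := semicircleDensity σ m + η)) fun s hs => by
            linarith [(abs_lt.mp (hclose s hs)).2]
        rw [intervalIntegral.integral_const, smul_eq_mul] at this
        linarith
      filter_upwards [ih m ⟨ham, hmy.trans hy.2⟩ hmj,
        eventually_le_scaledCount_of_lt_density hc hαlim hβlim hq hσ hσc hmy
          (r := semicircleDensity σ m - η)
          fun s hs => by linarith [(abs_lt.mp (hclose s hs)).1]] with n h1 h2
      rw [← scaledCount_add n (hα n) ham hmy,
        ← intervalIntegral.integral_add_adjacent_intervals (hint a m) (hint m y)]
      have h3 := mul_le_mul_of_nonneg_left hle (Nat.cast_nonneg (α := ℝ) n)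
      push_cast
      linarith
  obtain ⟨j, hj⟩ := exists_nat_ge ((b - a) / (δ / 2))
  have hlarge : ∀ᶠ n : ℕ in atTop, (j : ℝ) / n < ε / 2 :=
    (tendsto_const_div_atTop_nhds_zero_nat (j : ℝ)).eventually_lt_const (by positivity)
  filter_upwards [key j b ⟨hab, le_rfl⟩ ((div_le_iff₀ (by positivity)).mp hj), hlarge,
    eventually_gt_atTop 0] with n h1 h2 h3
  have h3' : (0 : ℝ) < n := by exact_mod_cast h3
  rw [div_lt_iff₀ h3'] at h2
  rw [le_div_iff₀ h3']
  have h4 := mul_lt_mul_of_pos_left hηε h3'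
  linarith

end Asymptotics

theorem stmt3 (α β : ℕ → ℝ) (c : ℝ) (hc : c > 0)
    (hα : ∀ n, α n > -1) (hβ : ∀ n, β n > -1)
    (hαlim : Tendsto (fun n : ℕ => α n / n) atTop atTop)
    (hβlim : Tendsto (fun n : ℕ => β n / n) atTop atTop)
    (hq : Tendsto (fun n : ℕ => α n / β n) atTop (𝓝 c))
    (σ : ℝ) (hσ : σ = 4 * c / (1 + c) ^ ((3 : ℝ) / 2))
    (ξ : ℝ) (hξ : |ξ| ≤ σ) :
    Tendsto (fun n : ℕ =>
        (jacobiN n (α n) (β n)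
          (Real.sqrt ((n : ℝ) / α n) * ξ - (α n - β n) / (α n + β n)) : ℝ) / n)
      atTop (𝓝 (2 / (Real.pi * σ ^ 2) * ∫ x in (-σ)..ξ, Real.sqrt (σ ^ 2 - x ^ 2))) := by
  have hσ0 : 0 < σ := by rw [hσ]; positivity
  have hσc : σ ^ 2 * (1 + c) ^ 3 = 16 * c ^ 2 := by
    have h1 : ((1 + c) ^ ((3 : ℝ) / 2)) ^ 2 = (1 + c) ^ 3 := by
      rw [← Real.rpow_natCast, ← Real.rpow_mul (by positivity), ← Real.rpow_natCast]
      norm_num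
    rw [hσ, div_pow, h1]
    field_simp
    ring
  obtain ⟨hξ1, hξ2⟩ := abs_le.mp hξ
  have htot := integral_semicircleDensity hσ0
  rw [← intervalIntegral.integral_add_adjacent_intervals (b := ξ)
    ((continuous_semicircleDensity σ).intervalIntegrable _ _)
    ((continuous_semicircleDensity σ).intervalIntegrable _ _)] at htot
  rw [← intervalIntegral.integral_const_mul]
  change Tendsto (fun n : ℕ => (jacobiN n (α n) (β n) (jacobiScale n (α n) (β n) ξ) : ℝ) / n)
    atTop (𝓝 (∫ s in (-σ)..ξ, semicircleDensity σ s))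
  rw [Metric.tendsto_nhds]
  intro ε hε
  filter_upwards [eventually_integral_le_scaledCount hc hα hαlim hβlim hq hσ0 hσc hξ1
      (half_pos hε),
    eventually_integral_le_scaledCount hc hα hαlim hβlim hq hσ0 hσc hξ2 (half_pos hε),
    eventually_gt_atTop 0] with n h1 h2 h3
  have h3' : (0 : ℝ) < n := by exact_mod_cast h3
  have hfin := finite_setOf_jacobiP_eq_zero (n := n) (β := β n) (hα n)
  have hlow : scaledCount n (α n) (β n) (-σ) ξ ≤
      jacobiN n (α n) (β n) (jacobiScale n (α n) (β n) ξ) :=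
    Set.ncard_le_ncard (fun x hx => ⟨hx.1, hx.2.2⟩) (hfin.inter_of_left _)
  have hup : jacobiN n (α n) (β n) (jacobiScale n (α n) (β n) ξ) +
      scaledCount n (α n) (β n) ξ σ ≤ n := by
    refine le_trans ?_ (ncard_setOf_jacobiP_eq_zero_le (n := n) (β := β n) (hα n))
    unfold jacobiN scaledCount
    rw [← Set.ncard_union_eq _ (hfin.subset fun x hx => hx.1) (hfin.inter_of_left _)]
    · exact Set.ncard_le_ncard (Set.union_subset (fun x hx => hx.1) fun x hx => hx.1) hfin
    · exact Set.disjoint_left.mpr fun x hx hx' => (hx.2.trans_lt hx'.2.1).false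
  have hlow' : (scaledCount n (α n) (β n) (-σ) ξ : ℝ) / n ≤
      jacobiN n (α n) (β n) (jacobiScale n (α n) (β n) ξ) / n := by
    gcongr
  have hup' : (jacobiN n (α n) (β n) (jacobiScale n (α n) (β n) ξ) : ℝ) / n +
      scaledCount n (α n) (β n) ξ σ / n ≤ 1 := by
    rw [← add_div, div_le_one h3']
    exact_mod_cast hup
  rw [Real.dist_eq, abs_lt]
  constructor <;> linarith
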